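/- arXiv:2112.00135 — 2 statements merged into one kernel-verified Lean document; each statement's English description precedes it below -/
import Mathlib

section
/- For μ ∈ (0,1/2], set A'(μ) = (2λ₁ + λ₂ − 4), B'(μ) = 3λ₁(λ₂ − λ₁), and D'(μ) = A'(μ)² − 4B'(μ) (the discriminant governing the planar linearization at the equilibria L₃ = (0, λ₁^{−1/3}, 0) and L₄ = (0, −λ₁^{−1/3}, 0)). Let μ₀ = (1/450)(225 − √(3(5227 + 2368√21))). Then μ₀ ∈ (0, 1/2), D'(μ₀) = 0, D'(μ) > 0 for all μ ∈ (0, μ₀), and D'(μ) < 0 for all μ ∈ (μ₀, 1/2]. -/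
/- Spatial Hill four-body problem: vector field and (reversing) symmetries. -/

noncomputable section

/-- `d = √(1 − 3μ + 3μ²)`. -/
def dparam (μ : ℝ) : ℝ := Real.sqrt (1 - 3*μ + 3*μ^2)

/-- `λ₂ = (3/2)(1 + d)`. -/
def lam2 (μ : ℝ) : ℝ := (3/2) * (1 + dparam μ)

/-- `λ₁ = (3/2)(1 − d)`. -/
def lam1 (μ : ℝ) : ℝ := (3/2) * (1 - dparam μ)


/-- `A'(μ) = 2λ₁ + λ₂ − 4`. -/
def Acoef' (μ : ℝ) : ℝ := 2 * lam1 μ + lam2 μ - 4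

/-- `B'(μ) = 3λ₁(λ₂ − λ₁)`. -/
def Bcoef' (μ : ℝ) : ℝ := 3 * lam1 μ * (lam2 μ - lam1 μ)

/-- `D'(μ) = A'(μ)² − 4B'(μ)`, the discriminant governing the planar linearization at the
equilibria `L₃ = (0, λ₁^{−1/3}, 0)` and `L₄ = (0, −λ₁^{−1/3}, 0)`. -/
def Dcoef' (μ : ℝ) : ℝ := (Acoef' μ)^2 - 4 * Bcoef' μ

/-- `μ₀ = (1/450)(225 − √(3(5227 + 2368√21)))`. -/
noncomputable def mu0 : ℝ := (1/450) * (225 - Real.sqrt (3 * (5227 + 2368 * Real.sqrt 21)))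

theorem Dcoef'_eq_dparam (μ : ℝ) :
    Dcoef' μ = (225 * dparam μ ^ 2 - 222 * dparam μ + 1) / 4 := by
  unfold Dcoef' Acoef' Bcoef' lam1 lam2
  ring

theorem Dcoef'_eq_factors (μ : ℝ) :
    Dcoef' μ = 225 / 4 * ((dparam μ - (37 + 8 * √21) / 75) *
      (dparam μ - (37 - 8 * √21) / 75)) := by
  have h : √21 ^ 2 = (21 : ℝ) := Real.sq_sqrt (by norm_num)
  rw [Dcoef'_eq_dparam]
  linear_combination (16 / 25 : ℝ) * h

theorem dparam_sq (μ : ℝ) : dparam μ ^ 2 = 3 * (1 / 2 - μ) ^ 2 + 1 / 4 := by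
  unfold dparam
  rw [Real.sq_sqrt (by nlinarith [sq_nonneg (μ - 1 / 2)])]
  ring

theorem half_le_dparam (μ : ℝ) : 1 / 2 ≤ dparam μ :=
  Real.le_sqrt_of_sq_le (by nlinarith [sq_nonneg (μ - 1 / 2)])

theorem dparam_lt_dparam {μ ν : ℝ} (h : μ < ν) (hν : ν ≤ 1 / 2) : dparam ν < dparam μ := by
  refine lt_of_pow_lt_pow_left₀ 2 (Real.sqrt_nonneg _) ?_
  rw [dparam_sq, dparam_sq]
  nlinarith

theorem sqrt_twentyone_mem : √21 ∈ Set.Ioo (4.58 : ℝ) 4.59 :=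
  ⟨Real.lt_sqrt_of_sq_lt (by norm_num), (Real.sqrt_lt' (by norm_num)).2 (by norm_num)⟩

theorem mu0_mem : mu0 ∈ Set.Ioo (0 : ℝ) (1 / 2) := by
  obtain ⟨h₁, h₂⟩ := sqrt_twentyone_mem
  have hpos : 0 < √(3 * (5227 + 2368 * √21)) := Real.sqrt_pos.2 (by positivity)
  have hlt : √(3 * (5227 + 2368 * √21)) < 225 :=
    (Real.sqrt_lt' (by norm_num)).2 (by linarith)
  unfold mu0
  constructor <;> linarith

theorem dparam_mu0 : dparam mu0 = (37 + 8 * √21) / 75 := by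
  have h : √21 ^ 2 = (21 : ℝ) := Real.sq_sqrt (by norm_num)
  have hS : √(3 * (5227 + 2368 * √21)) ^ 2 = 3 * (5227 + 2368 * √21) :=
    Real.sq_sqrt (by positivity)
  refine (pow_left_inj₀ (Real.sqrt_nonneg _) (by positivity) two_ne_zero).1 ?_
  change dparam mu0 ^ 2 = _
  rw [dparam_sq, mu0]
  linear_combination (1 / 67500 : ℝ) * hS - (64 / 5625 : ℝ) * h

/-- `μ₀ ∈ (0, 1/2)`, `D'(μ₀) = 0`, `D' > 0` on `(0, μ₀)`, and `D' < 0` on `(μ₀, 1/2]`. -/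
theorem discriminant_sign_change_at_mu0 :
    mu0 ∈ Set.Ioo (0:ℝ) (1/2) ∧
    Dcoef' mu0 = 0 ∧
    (∀ μ ∈ Set.Ioo (0:ℝ) mu0, 0 < Dcoef' μ) ∧
    (∀ μ ∈ Set.Ioc mu0 (1/2:ℝ), Dcoef' μ < 0) := by
  have hfac (μ : ℝ) : 0 < dparam μ - (37 - 8 * √21) / 75 := by
    linarith [half_le_dparam μ, sqrt_twentyone_mem.1]
  refine ⟨mu0_mem, ?_, fun μ hμ => ?_, fun μ hμ => ?_⟩
  · rw [Dcoef'_eq_factors, dparam_mu0]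
    ring
  · have h := dparam_lt_dparam hμ.2 mu0_mem.2.le
    rw [dparam_mu0] at h
    rw [Dcoef'_eq_factors]
    exact mul_pos (by norm_num) (mul_pos (sub_pos.2 h) (hfac μ))
  · have h := dparam_lt_dparam hμ.1 hμ.2
    rw [dparam_mu0] at h
    rw [Dcoef'_eq_factors]
    exact mul_neg_of_pos_of_neg (by norm_num) (mul_neg_of_neg_of_pos (sub_neg.2 h) (hfac μ))

end
end

section
/- For each integer k ≥ 2, set K = (k² − 1)²/(k² + 1)², r = √(84 − 3K), and μ_k = 1/2 − (1/(6√3))·√((5227 + 1184r − 5K² − 32Kr − 38K)/(K − 25)²). Then μ_k ∈ (0, μ₀), and at μ = μ_k the two frequencies at L₃ are in k:1 resonance: if ω₁, ω₂ > 0 are the numbers such that {−ω₁², −ω₂²} are the roots of t² − (2λ₁ + λ₂ − 4)t + 3λ₁(λ₂ − λ₁) evaluated at μ = μ_k (with ω₁ ≤ ω₂), then ω₂ = k·ω₁; equivalently, k²·(2λ₁ + λ₂ − 4)² = (k² + 1)²·3λ₁(λ₂ − λ₁) at μ = μ_k. -/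
/- Spatial Hill four-body problem: vector field and (reversing) symmetries. -/

noncomputable section

/-- `K = (k² − 1)²/(k² + 1)²`. -/
def Kres (k : ℕ) : ℝ := ((k:ℝ)^2 - 1)^2 / ((k:ℝ)^2 + 1)^2

/-- `r = √(84 − 3K)`. -/
def rres (k : ℕ) : ℝ := Real.sqrt (84 - 3 * Kres k)

/-- `μ_k = 1/2 − (1/(6√3))·√((5227 + 1184r − 5K² − 32Kr − 38K)/(K − 25)²)`. -/
def mures (k : ℕ) : ℝ :=
  1/2 - (1 / (6 * Real.sqrt 3)) *
    Real.sqrt ((5227 + 1184 * rres k - 5 * (Kres k)^2 - 32 * Kres k * rres k - 38 * Kres k)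
      / (Kres k - 25)^2)

/-- The value of `d` at the resonant mass parameter: `D = (37 − K + 4r)/(3(25 − K))`. -/
def dres (k : ℕ) : ℝ := (37 - Kres k + 4 * rres k) / (3 * (25 - Kres k))

theorem Kres_pos {k : ℕ} (hk : 2 ≤ k) : 0 < Kres k := by
  have h : (2:ℝ) ≤ k := by exact_mod_cast hk
  have h1 : 0 < (k:ℝ)^2 - 1 := by nlinarith
  unfold Kres
  positivity

theorem one_sub_Kres (k : ℕ) : (1 - Kres k) * ((k:ℝ)^2 + 1)^2 = 4 * (k:ℝ)^2 := by
  unfold Kres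
  field_simp
  ring

theorem Kres_lt_one {k : ℕ} (hk : 2 ≤ k) : Kres k < 1 := by
  have h : (2:ℝ) ≤ k := by exact_mod_cast hk
  have h1 := one_sub_Kres k
  by_contra! hK
  nlinarith [mul_nonneg (sub_nonneg.2 hK) (sq_nonneg ((k:ℝ)^2 + 1))]

theorem rres_sq {k : ℕ} (hk : 2 ≤ k) : rres k ^ 2 = 84 - 3 * Kres k :=
  Real.sq_sqrt (by linarith [Kres_lt_one hk])

theorem nine_le_rres {k : ℕ} (hk : 2 ≤ k) : 9 ≤ rres k :=
  Real.le_sqrt_of_sq_le (by linarith [Kres_lt_one hk])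

theorem dres_mul {k : ℕ} (hk : 2 ≤ k) :
    dres k * (3 * (25 - Kres k)) = 37 - Kres k + 4 * rres k :=
  div_mul_cancel₀ _ (by linarith [Kres_lt_one hk])

theorem dres_lt_one {k : ℕ} (hk : 2 ≤ k) : dres k < 1 := by
  have hK := Kres_lt_one hk
  have hr := nine_le_rres hk
  have hr2 := rres_sq hk
  unfold dres
  rw [div_lt_one (by linarith)]
  by_contra! h
  nlinarith [mul_pos (sub_pos.2 hK) (by linarith : (0:ℝ) < 25 - Kres k)]

/-- The value of `d` at `μ₀` is `(37 + 8√21)/75`. -/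
theorem lt_dres {k : ℕ} (hk : 2 ≤ k) : (37 + 8 * Real.sqrt 21) / 75 < dres k := by
  have hK := Kres_lt_one hk
  have hK0 := Kres_pos hk
  have hr := nine_le_rres hk
  have hr2 := rres_sq hk
  have hs2 : Real.sqrt 21 ^ 2 = 21 := Real.sq_sqrt (by norm_num)
  have hs : 4 ≤ Real.sqrt 21 := Real.le_sqrt_of_sq_le (by norm_num)
  have hgap : 17 * (2 * Real.sqrt 21 - rres k) ≤ 3 * Kres k := by
    have hprod : (2 * Real.sqrt 21 - rres k) * (2 * Real.sqrt 21 + rres k) = 3 * Kres k := by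
      linear_combination 4 * hs2 - hr2
    have h0 : 0 ≤ 2 * Real.sqrt 21 - rres k := by
      by_contra! h
      nlinarith
    nlinarith
  unfold dres
  rw [div_lt_div_iff₀ (by norm_num) (by linarith)]
  nlinarith [mul_nonneg hK0.le (sub_nonneg.2 hs)]

theorem mures_eq {k : ℕ} (hk : 2 ≤ k) :
    mures k = 1/2 - Real.sqrt ((dres k ^ 2 - 1/4) / 3) := by
  have hK := Kres_lt_one hk
  have hc : 1 / (6 * Real.sqrt 3) = Real.sqrt (1 / 108) := by
    rw [show (1:ℝ) / 108 = 1 / (6^2 * 3) by norm_num, Real.sqrt_div zero_le_one,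
      Real.sqrt_mul (by norm_num), Real.sqrt_sq (by norm_num), Real.sqrt_one]
  unfold mures
  rw [hc, ← Real.sqrt_mul (by norm_num)]
  congr 2
  have h1 : Kres k - 25 ≠ 0 := by linarith
  have h2 : 25 - Kres k ≠ 0 := by linarith
  rw [dres, show (Kres k - 25)^2 = (25 - Kres k)^2 by ring]
  field_simp
  linear_combination (-6912) * rres_sq hk

theorem mu0_eq : mu0 = 1/2 - Real.sqrt ((((37 + 8 * Real.sqrt 21) / 75)^2 - 1/4) / 3) := by
  have hs2 : Real.sqrt 21 ^ 2 = 21 := Real.sq_sqrt (by norm_num)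
  have h : (((37 + 8 * Real.sqrt 21) / 75)^2 - 1/4) / 3
      = (1/450)^2 * (3 * (5227 + 2368 * Real.sqrt 21)) := by
    linear_combination (64/16875) * hs2
  rw [h, Real.sqrt_mul (by positivity), Real.sqrt_sq (by norm_num), mu0]
  ring

theorem half_lt_dres {k : ℕ} (hk : 2 ≤ k) : 1/2 < dres k := by
  have hs : 4 ≤ Real.sqrt 21 := Real.le_sqrt_of_sq_le (by norm_num)
  linarith [lt_dres hk]

theorem dparam_mures {k : ℕ} (hk : 2 ≤ k) : dparam (mures k) = dres k := by
  have hD := half_lt_dres hk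
  have hsq := Real.sq_sqrt (show 0 ≤ (dres k ^ 2 - 1/4) / 3 by nlinarith)
  rw [dparam, mures_eq hk, ← Real.sqrt_sq (by linarith : 0 ≤ dres k)]
  congr 1
  rw [Real.sqrt_sq (by linarith)]
  linear_combination 3 * hsq

theorem mures_mem_Ioo {k : ℕ} (hk : 2 ≤ k) : mures k ∈ Set.Ioo (0:ℝ) mu0 := by
  have hs : 4 ≤ Real.sqrt 21 := Real.le_sqrt_of_sq_le (by norm_num)
  have h1 := dres_lt_one hk
  have h2 := half_lt_dres hk
  have h3 := lt_dres hk
  constructor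
  · rw [mures_eq hk, sub_pos, Real.sqrt_lt' (by norm_num)]
    nlinarith
  · rw [mures_eq hk, mu0_eq]
    refine sub_lt_sub_left (Real.sqrt_lt_sqrt ?_ (by gcongr)) _
    nlinarith

/-- The resonance relation `(1 − K)(1 − 3d)² = 216 d(1 − d)` satisfied by `dres k`. -/
theorem dres_resonance {k : ℕ} (hk : 2 ≤ k) :
    (1 - Kres k) * (1 - 3 * dres k)^2 = 216 * (dres k * (1 - dres k)) := by
  have h2 : 25 - Kres k ≠ 0 := by linarith [Kres_lt_one hk]
  apply mul_left_cancel₀ h2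
  have hD := dres_mul hk
  have hr2 := rres_sq hk
  linear_combination
    (dres k * (3 * (25 - Kres k)) - (37 - Kres k) + 4 * rres k) * hD + 16 * hr2

theorem frequency_relation {k : ℕ} (hk : 2 ≤ k) :
    (k:ℝ)^2 * (2 * lam1 (mures k) + lam2 (mures k) - 4)^2
      = ((k:ℝ)^2 + 1)^2 * (3 * lam1 (mures k) * (lam2 (mures k) - lam1 (mures k))) := by
  rw [lam1, lam2, dparam_mures hk]
  linear_combination (1/16) * ((k:ℝ)^2 + 1)^2 * dres_resonance hk
    - (1/16) * (1 - 3 * dres k)^2 * one_sub_Kres k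

theorem eq_mul_of_resonance {κ a b : ℝ} (hκ : 1 < κ) (ha : 0 < a) (hab : a ≤ b)
    (h : κ^2 * (a^2 + b^2)^2 = (κ^2 + 1)^2 * (a^2 * b^2)) : b = κ * a := by
  have hb : 0 < b := ha.trans_le hab
  have hlin : κ * (a^2 + b^2) = (κ^2 + 1) * (a * b) := by
    rw [← sq_eq_sq₀ (by positivity) (by positivity)]
    linear_combination h
  have hprod : (b - κ * a) * (κ * b - a) = 0 := by linear_combination hlin
  rcases mul_eq_zero.1 hprod with h1 | h1
  · linarith
  · nlinarith

/-- For each integer `k ≥ 2`, the resonant mass parameter `μ_k` lies in `(0, μ₀)` and at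
`μ = μ_k` the two planar frequencies at `L₃` are in `k:1` resonance: if `ω₁ ≤ ω₂` are
positive with `{−ω₁², −ω₂²}` the roots of `t² − (2λ₁ + λ₂ − 4)t + 3λ₁(λ₂ − λ₁)` at `μ_k`,
then `ω₂ = k·ω₁`; equivalently `k²(2λ₁ + λ₂ − 4)² = (k² + 1)²·3λ₁(λ₂ − λ₁)` at `μ_k`. -/
theorem resonant_mass_parameters (k : ℕ) (hk : 2 ≤ k) :
    mures k ∈ Set.Ioo (0:ℝ) mu0 ∧
    (∀ ω₁ ω₂ : ℝ, 0 < ω₁ → 0 < ω₂ → ω₁ ≤ ω₂ →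
      (∀ t : ℝ, t^2 - (2 * lam1 (mures k) + lam2 (mures k) - 4) * t
          + 3 * lam1 (mures k) * (lam2 (mures k) - lam1 (mures k))
        = (t + ω₁^2) * (t + ω₂^2)) →
      ω₂ = (k:ℝ) * ω₁) ∧
    (k:ℝ)^2 * (2 * lam1 (mures k) + lam2 (mures k) - 4)^2
      = ((k:ℝ)^2 + 1)^2 * (3 * lam1 (mures k) * (lam2 (mures k) - lam1 (mures k))) := by
  have hrel := frequency_relation hk
  refine ⟨mures_mem_Ioo hk, fun ω₁ ω₂ h₁ _ hle hroots => ?_, hrel⟩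
  have hκ : (1:ℝ) < k := by exact_mod_cast hk
  refine eq_mul_of_resonance hκ h₁ hle ?_
  have hprod := hroots 0
  have hsum : 2 * lam1 (mures k) + lam2 (mures k) - 4 = -(ω₁^2 + ω₂^2) := by
    linear_combination hprod - hroots 1
  rw [hsum] at hrel
  linear_combination hrel + ((k:ℝ)^2 + 1)^2 * hprod

end
end
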